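/- arXiv:1910.01869 — 4 statements merged into one kernel-verified Lean document; each statement's English description precedes it below -/
import Mathlib

section
/- If a job (K, f) with |K| = n is doable, then there exists an enumeration k_1, k_2, …, k_n of the tasks of K (a bijection from {1,…,n} to K) such that for every j ∈ {1,…,n} there is a feasibility set A ∈ f(k_j) with A ⊆ {k_1, …, k_{j-1}}. (This is the completion order in which the tasks of a single injected doable job can be executed under a work-conserving policy.) -/
/-- A task `k` is feasible with respect to a set `C` of completed tasks if some
feasibility set `A ∈ f k` satisfies `A ⊆ C`. -/
def Feasible {τ : Type*} (f : τ → Set (Set τ)) (C : Set τ) (k : τ) : Prop :=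
  ∃ A ∈ f k, A ⊆ C

/-- The feasibility operator `F(C) = {k ∈ K : k is feasible w.r.t. C}`. -/
def FeasOp {τ : Type*} (K : Set τ) (f : τ → Set (Set τ)) (C : Set τ) : Set τ :=
  {k ∈ K | Feasible f C k}

/-- The iterated feasibility sets: `U 0 = ∅`, `U (j+1) = F (U j)`. -/
def U {τ : Type*} (K : Set τ) (f : τ → Set (Set τ)) : ℕ → Set τ
  | 0 => ∅
  | j + 1 => FeasOp K f (U K f j)

/-- A job `(K, f)` is doable if every task is assigned a layer,
i.e. `K = ⋃ j, U j`. -/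
def Doable {τ : Type*} (K : Set τ) (f : τ → Set (Set τ)) : Prop :=
  K ⊆ ⋃ j, U K f j

/-- Task `k` is assigned layer `j` if `j` is the least index with `k ∈ U j`. -/
def AssignedLayer {τ : Type*} (K : Set τ) (f : τ → Set (Set τ)) (k : τ) (j : ℕ) : Prop :=
  k ∈ U K f j ∧ ∀ i < j, k ∉ U K f i
theorem U_subset {τ : Type*} (K : Set τ) (f : τ → Set (Set τ)) : ∀ j, U K f j ⊆ K
  | 0 => Set.empty_subset K
  | _ + 1 => fun _ hk => hk.1

/-- The least `j` with `k ∈ U j`, when there is one. -/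
noncomputable def layer {τ : Type*} (K : Set τ) (f : τ → Set (Set τ)) (k : τ) : ℕ :=
  sInf {j | k ∈ U K f j}

theorem layer_le_of_mem_U {τ : Type*} {K : Set τ} {f : τ → Set (Set τ)} {k : τ} {j : ℕ}
    (hk : k ∈ U K f j) : layer K f k ≤ j :=
  Nat.sInf_le hk

/-- Every task of a doable job has a feasibility set consisting of tasks of strictly
smaller layer. -/
theorem Doable.exists_feasibility_set_layer_lt {τ : Type*} {K : Set τ} {f : τ → Set (Set τ)}
    (hdoable : Doable K f) {k : τ} (hk : k ∈ K) :
    ∃ A ∈ f k, ∀ a ∈ A, a ∈ K ∧ layer K f a < layer K f k := by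
  have hmem : k ∈ U K f (layer K f k) :=
    Nat.sInf_mem (s := {j | k ∈ U K f j}) (Set.mem_iUnion.mp (hdoable hk))
  cases hj : layer K f k with
  | zero => rw [hj] at hmem; exact hmem.elim
  | succ j =>
    rw [hj] at hmem
    obtain ⟨-, A, hA, hAU⟩ := hmem
    exact ⟨A, hA, fun a ha =>
      ⟨U_subset K f j (hAU ha), Nat.lt_succ_of_le (layer_le_of_mem_U (hAU ha))⟩⟩

/-- If a job `(K, f)` with `|K| = n` is doable, then there is an enumeration
`k_1, …, k_n` of its tasks such that every `k_j` has a feasibility set contained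
in `{k_1, …, k_{j-1}}`. -/
theorem doable_exists_completion_order {τ : Type*} (K : Finset τ)
    (f : τ → Set (Set τ)) (hdoable : Doable (↑K) f) :
    ∃ e : Fin K.card → τ,
      Function.Injective e ∧ (∀ i, e i ∈ K) ∧ (∀ k ∈ K, ∃ i, e i = k) ∧
      ∀ j : Fin K.card, ∃ A ∈ f (e j), A ⊆ {a | ∃ i : Fin K.card, i < j ∧ e i = a} := by
  let g : Fin K.card → ℕ := fun i => layer (↑K) f (K.equivFin.symm i)
  let e : Fin K.card ≃ K := (Tuple.sort g).trans K.equivFin.symm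
  have hmono : Monotone fun i => layer (↑K) f (e i : τ) := Tuple.monotone_sort g
  refine ⟨fun i => e i, Subtype.val_injective.comp e.injective, fun i => (e i).2,
    fun k hk => ⟨e.symm ⟨k, hk⟩, by simp⟩, fun j => ?_⟩
  obtain ⟨A, hA, hlt⟩ := hdoable.exists_feasibility_set_layer_lt (e j).2
  refine ⟨A, hA, fun a ha => ?_⟩
  obtain ⟨haK, hal⟩ := hlt a ha
  have hea : (e (e.symm ⟨a, haK⟩) : τ) = a := by simp
  exact ⟨e.symm ⟨a, haK⟩, hmono.reflect_lt (by simpa only [hea] using hal), hea⟩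
end

section
/- Let (K, f) be a job with |K| = n. If there exists an enumeration k_1, k_2, …, k_n of the tasks of K (a bijection from {1,…,n} to K) such that for every j ∈ {1,…,n} there is a feasibility set A ∈ f(k_j) with A ⊆ {k_1, …, k_{j-1}}, then (K, f) is doable. (This is the converse direction of the characterization: a job that can be completed must be doable.) -/
/-- If every task in an enumeration has a feasibility set among its predecessors, then `U m`
contains the first `m` tasks. -/
theorem mem_U_of_completion_order {τ : Type*} {K : Set τ} {f : τ → Set (Set τ)} {n : ℕ}
    {e : Fin n → τ} (hmem : ∀ i, e i ∈ K)
    (horder : ∀ j : Fin n, ∃ A ∈ f (e j), A ⊆ {a | ∃ i : Fin n, i < j ∧ e i = a})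
    (m : ℕ) (i : Fin n) (hi : i.val < m) : e i ∈ U K f m := by
  induction m generalizing i with
  | zero => exact absurd hi (Nat.not_lt_zero _)
  | succ m ih =>
    obtain ⟨A, hA, hsub⟩ := horder i
    refine ⟨hmem i, A, hA, fun a ha => ?_⟩
    obtain ⟨i', hlt, rfl⟩ := hsub ha
    exact ih i' (lt_of_lt_of_le hlt (Nat.lt_succ_iff.mp hi))

/-- If a job `(K, f)` with `|K| = n` has an enumeration `k_1, …, k_n` of its
tasks such that every `k_j` has a feasibility set contained in
`{k_1, …, k_{j-1}}`, then the job is doable. -/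
theorem doable_of_completion_order {τ : Type*} (K : Finset τ)
    (f : τ → Set (Set τ)) (e : Fin K.card → τ)
    (hinj : Function.Injective e) (hmem : ∀ i, e i ∈ K)
    (hsurj : ∀ k ∈ K, ∃ i, e i = k)
    (horder : ∀ j : Fin K.card, ∃ A ∈ f (e j),
      A ⊆ {a | ∃ i : Fin K.card, i < j ∧ e i = a}) :
    Doable (↑K) f := by
  intro k hk
  obtain ⟨i, rfl⟩ := hsurj k hk
  exact Set.mem_iUnion.mpr
    ⟨K.card, mem_U_of_completion_order (fun i => Finset.mem_coe.mpr (hmem i)) horder _ i i.isLt⟩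
end

section
/- If a job (K, f) is doable, then for every proper subset C ⊊ K there exists a task k ∈ K \ C that is feasible with respect to C, i.e., some feasibility set A ∈ f(k) satisfies A ⊆ C. (Until a doable job is completed, there is always at least one feasible task that is not yet completed.) -/
/-- If every task of `K` feasible with respect to `C` lies in `C`, then every iterate `U K f j`
is contained in `C`. -/
theorem U_subset_of_feasOp_subset {τ : Type*} {K : Set τ} {f : τ → Set (Set τ)} {C : Set τ}
    (h : FeasOp K f C ⊆ C) (j : ℕ) : U K f j ⊆ C := by
  induction j with
  | zero => exact Set.empty_subset C
  | succ j ih =>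
    rintro k ⟨hk, A, hA, hAU⟩
    exact h ⟨hk, A, hA, hAU.trans ih⟩

/-- If a job `(K, f)` is doable, then for every proper subset `C ⊊ K` there is
a task in `K \ C` that is feasible with respect to `C`. -/
theorem doable_exists_feasible_task {τ : Type*} (K : Finset τ)
    (f : τ → Set (Set τ)) (hdoable : Doable (↑K) f)
    (C : Set τ) (hC : C ⊂ ↑K) :
    ∃ k ∈ (↑K : Set τ) \ C, Feasible f C k := by
  by_contra! hnone
  refine hC.not_subset (hdoable.trans (Set.iUnion_subset (U_subset_of_feasOp_subset ?_)))
  rintro k ⟨hk, hfeas⟩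
  by_contra hkC
  exact hnone k ⟨hk, hkC⟩ hfeas
end

section
/- The skeleton of a job does not determine whether it is doable: let K = {1,2,3,4,5} and define two feasibility functions f and g on K by f(1) = g(1) = {∅}, f(2) = {{1,5}}, g(2) = {{1},{5}}, and f(i) = g(i) = {{i−1}} for i ∈ {3,4,5}. Then the jobs (K, f) and (K, g) have the same skeleton (the same dependence relation: for every pair of tasks k', k, task k depends on k' under f if and only if it does under g), the job (K, g) is doable, and the job (K, f) is not doable. -/
/-- Task `k` depends on task `k'` if some feasibility set of `k` contains `k'`.
The skeleton of a job is the directed graph of this dependence relation. -/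
def Depends {τ : Type*} (f : τ → Set (Set τ)) (k k' : τ) : Prop :=
  ∃ A ∈ f k, k' ∈ A

/-- The skeleton of a job does not determine whether it is doable: the jobs
`(K, f)` and `(K, g)` below have the same skeleton, yet `(K, g)` is doable
while `(K, f)` is not. -/
theorem skeleton_does_not_determine_doable
    (f g : ℕ → Set (Set ℕ))
    (hf1 : f 1 = {∅}) (hf2 : f 2 = {{1, 5}}) (hf3 : f 3 = {{2}})
    (hf4 : f 4 = {{3}}) (hf5 : f 5 = {{4}})
    (hg1 : g 1 = {∅}) (hg2 : g 2 = {{1}, {5}}) (hg3 : g 3 = {{2}})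
    (hg4 : g 4 = {{3}}) (hg5 : g 5 = {{4}}) :
    (∀ k ∈ ({1, 2, 3, 4, 5} : Set ℕ), ∀ k' ∈ ({1, 2, 3, 4, 5} : Set ℕ),
      (Depends f k k' ↔ Depends g k k')) ∧
    Doable ({1, 2, 3, 4, 5} : Set ℕ) g ∧
    ¬ Doable ({1, 2, 3, 4, 5} : Set ℕ) f := by
  refine ⟨?_, ?_, fun h => ?_⟩
  · rintro k (rfl | rfl | rfl | rfl | rfl) k' -
    · simp [Depends, hf1, hg1]
    · simp [Depends, hf2, hg2]
    · simp [Depends, hf3, hg3]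
    · simp [Depends, hf4, hg4]
    · simp [Depends, hf5, hg5]
  · have h1 : 1 ∈ U {1, 2, 3, 4, 5} g 1 := ⟨by simp, by simp [Feasible, hg1]⟩
    have h2 : 2 ∈ U {1, 2, 3, 4, 5} g 2 :=
      ⟨by simp, {1}, by simp [hg2], Set.singleton_subset_iff.2 h1⟩
    have h3 : 3 ∈ U {1, 2, 3, 4, 5} g 3 :=
      ⟨by simp, {2}, by simp [hg3], Set.singleton_subset_iff.2 h2⟩
    have h4 : 4 ∈ U {1, 2, 3, 4, 5} g 4 :=
      ⟨by simp, {3}, by simp [hg4], Set.singleton_subset_iff.2 h3⟩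
    have h5 : 5 ∈ U {1, 2, 3, 4, 5} g 5 :=
      ⟨by simp, {4}, by simp [hg5], Set.singleton_subset_iff.2 h4⟩
    rintro k (rfl | rfl | rfl | rfl | rfl)
    exacts [Set.mem_iUnion_of_mem 1 h1, Set.mem_iUnion_of_mem 2 h2, Set.mem_iUnion_of_mem 3 h3,
      Set.mem_iUnion_of_mem 4 h4, Set.mem_iUnion_of_mem 5 h5]
  · have key : ∀ j, U {1, 2, 3, 4, 5} f j ⊆ {1} := by
      intro j
      induction j with
      | zero => exact Set.empty_subset _
      | succ j ih =>
        rintro k ⟨rfl | rfl | rfl | rfl | rfl, A, hA, hAU⟩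
        · rfl
        all_goals
          have hA1 := hAU.trans ih
          simp_all [Set.insert_subset_iff]
    obtain ⟨j, hj⟩ := Set.mem_iUnion.1 (h (show 2 ∈ ({1, 2, 3, 4, 5} : Set ℕ) by simp))
    simpa using key j hj
end
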